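/- (Conjugate of a quadratic seminorm) Let A ∈ ℝ^{n×n} be symmetric positive semidefinite. The Fenchel conjugate of the function x ↦ (1/2)⟨Ax, x⟩ is the function y ↦ (1/2)⟨A^+y, y⟩ for y ∈ im(A), and +∞ for y ∉ im(A). -/

import Mathlib

open Matrix

/-- The four Penrose conditions characterizing the Moore–Penrose pseudoinverse. -/
def IsMoorePenroseInv {m n : Type*} [Fintype m] [Fintype n]
    (A : Matrix m n ℝ) (B : Matrix n m ℝ) : Prop :=
  A * B * A = A ∧ B * A * B = B ∧ (A * B)ᵀ = A * B ∧ (B * A)ᵀ = B * A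

open scoped Classical in
/-- The Moore–Penrose pseudoinverse `A^+` of a real matrix `A`. -/
noncomputable def pinv {m n : Type*} [Fintype m] [Fintype n]
    (A : Matrix m n ℝ) : Matrix n m ℝ :=
  if h : ∃ B, IsMoorePenroseInv A B then h.choose else 0

/-- The Euclidean dot product on `ℝ^n`. -/
def dotp {n : ℕ} (x y : Fin n → ℝ) : ℝ := ∑ i, x i * y i

/-- The Fenchel conjugate (with values in `EReal`) of a real-valued function on `ℝ^n`:
`g^*(y) = sup_x (⟨y, x⟩ − g(x))`. -/
noncomputable def fenchelConj {n : ℕ} (g : (Fin n → ℝ) → ℝ) (y : Fin n → ℝ) : EReal :=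
  ⨆ x : Fin n → ℝ, ((dotp y x - g x : ℝ) : EReal)

/-- Inverting the nonzero eigenvalues in an orthogonal diagonalization gives a
Moore–Penrose pseudoinverse. -/
theorem isMoorePenroseInv_conj_diagonal {n : Type*} [Fintype n] [DecidableEq n]
    {U : Matrix n n ℝ} (hU : Uᵀ * U = 1) (d : n → ℝ) :
    IsMoorePenroseInv (U * diagonal d * Uᵀ) (U * diagonal (fun i => (d i)⁻¹) * Uᵀ) := by
  have conj_mul (b c : n → ℝ) : U * diagonal b * Uᵀ * (U * diagonal c * Uᵀ) =
      U * diagonal (fun i => b i * c i) * Uᵀ := by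
    calc _ = U * diagonal b * (Uᵀ * U) * diagonal c * Uᵀ := by simp only [Matrix.mul_assoc]
      _ = _ := by rw [hU, Matrix.mul_one, Matrix.mul_assoc U, diagonal_mul_diagonal]
  have conj_transpose (c : n → ℝ) : (U * diagonal c * Uᵀ)ᵀ = U * diagonal c * Uᵀ := by
    simp [Matrix.mul_assoc]
  simp only [IsMoorePenroseInv, conj_mul, conj_transpose, mul_inv_mul_cancel, and_true]
  have h (i : n) : (d i)⁻¹ * d i * (d i)⁻¹ = (d i)⁻¹ := by
    simpa using mul_inv_mul_cancel (d i)⁻¹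
  simp only [h, and_self]

theorem Matrix.IsHermitian.exists_isMoorePenroseInv {n : Type*} [Fintype n]
    {A : Matrix n n ℝ} (hA : A.IsHermitian) : ∃ B, IsMoorePenroseInv A B := by
  classical
  have hU : (hA.eigenvectorUnitary : Matrix n n ℝ)ᵀ * hA.eigenvectorUnitary = 1 := by
    simpa [star_eq_conjTranspose] using Unitary.coe_star_mul_self hA.eigenvectorUnitary
  have hspec : A = hA.eigenvectorUnitary * diagonal hA.eigenvalues *
      (hA.eigenvectorUnitary : Matrix n n ℝ)ᵀ := by
    simpa [Unitary.conjStarAlgAut_apply, star_eq_conjTranspose, Function.comp_def]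
      using hA.spectral_theorem
  have h := isMoorePenroseInv_conj_diagonal hU hA.eigenvalues
  rw [← hspec] at h
  exact ⟨_, h⟩

theorem isMoorePenroseInv_pinv {m n : Type*} [Fintype m] [Fintype n]
    {A : Matrix m n ℝ} (h : ∃ B, IsMoorePenroseInv A B) : IsMoorePenroseInv A (pinv A) := by
  rw [pinv, dif_pos h]
  exact h.choose_spec

theorem dotp_eq_dotProduct {n : ℕ} (x y : Fin n → ℝ) : dotp x y = x ⬝ᵥ y := rfl

/-- **Conjugate of a quadratic seminorm.**
Let `A ∈ ℝ^{n×n}` be symmetric positive semidefinite. The Fenchel conjugate of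
`x ↦ (1/2)⟨Ax, x⟩` is `y ↦ (1/2)⟨A^+y, y⟩` for `y ∈ im(A)`, and `+∞` for `y ∉ im(A)`. -/
theorem conjugate_of_quadratic_seminorm {n : ℕ}
    (A : Matrix (Fin n) (Fin n) ℝ) (hA : A.PosSemidef) :
    (∀ y ∈ Set.range A.mulVec,
        fenchelConj (fun x => 1 / 2 * dotp (A.mulVec x) x) y =
          ((1 / 2 * dotp ((pinv A).mulVec y) y : ℝ) : EReal)) ∧
      ∀ y : Fin n → ℝ, y ∉ Set.range A.mulVec →
        fenchelConj (fun x => 1 / 2 * dotp (A.mulVec x) x) y = ⊤ := by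
  obtain ⟨hABA, -, hAB, -⟩ := isMoorePenroseInv_pinv hA.isHermitian.exists_isMoorePenroseInv
  have hT : Aᵀ = A := by simpa using hA.isHermitian.eq
  have hsymm (u v : Fin n → ℝ) : A *ᵥ u ⬝ᵥ v = u ⬝ᵥ A *ᵥ v := by
    rw [dotProduct_mulVec, ← mulVec_transpose, hT]
  simp only [fenchelConj, dotp_eq_dotProduct]
  refine ⟨?_, fun y hy => ?_⟩
  · rintro _ ⟨z, rfl⟩
    have hval : pinv A *ᵥ (A *ᵥ z) ⬝ᵥ A *ᵥ z = A *ᵥ z ⬝ᵥ z := by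
      rw [← hsymm, mulVec_mulVec, mulVec_mulVec, hABA]
    rw [hval]
    refine le_antisymm (iSup_le fun x => EReal.coe_le_coe_iff.2 ?_)
      (le_iSup_of_le z (EReal.coe_le_coe_iff.2 (by linarith)))
    have hnonneg : 0 ≤ (x - z) ⬝ᵥ A *ᵥ (x - z) := by
      simpa using hA.dotProduct_mulVec_nonneg (x - z)
    simp only [mulVec_sub, sub_dotProduct, dotProduct_sub, ← hsymm] at hnonneg
    have hcomm : A *ᵥ x ⬝ᵥ z = A *ᵥ z ⬝ᵥ x := by rw [hsymm, dotProduct_comm]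
    linarith
  · set w := y - A *ᵥ (pinv A *ᵥ y) with hw
    have hAAB : A * (A * pinv A) = A := by
      rw [← hAB, transpose_mul, hT]
      simpa [hT, Matrix.mul_assoc] using congrArg transpose hABA
    have hAw : A *ᵥ w = 0 := by
      rw [hw, mulVec_sub, mulVec_mulVec, mulVec_mulVec, Matrix.mul_assoc, hAAB, sub_self]
    have hw0 : w ≠ 0 := fun h => hy ⟨pinv A *ᵥ y, (sub_eq_zero.1 h).symm⟩
    have hyw : y ⬝ᵥ w = w ⬝ᵥ w := by
      have h : w ⬝ᵥ w = y ⬝ᵥ w - A *ᵥ (pinv A *ᵥ y) ⬝ᵥ w := by rw [← sub_dotProduct]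
      rw [h, hsymm, hAw, dotProduct_zero, sub_zero]
    have hww : w ⬝ᵥ w ≠ 0 := by simpa using hw0
    refine (EReal.eq_top_iff_forall_lt _).2 fun r => ?_
    refine lt_of_lt_of_le ?_ (le_iSup _ (((r + 1) / (w ⬝ᵥ w)) • w))
    rw [EReal.coe_lt_coe_iff]
    simp [mulVec_smul, hAw, hyw, hww]
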